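/- (Quantum Serre relations in the Hall algebra) Let Q be a quiver, i a vertex with no loops, (j, l) ≠ (i, 1) with j possibly equal to i or carrying loops, and set a_{ij} = -c_{ij} - c_{ji} for i ≠ j. Then in the twisted Ringel-Hall algebra over any finite field, ∑_{k=0}^{1 - l·a_{ij}} (-1)^k [E_i]^{(k)} [E_{j,l}] [E_i]^{(1 - l·a_{ij} - k)} = 0, where [E_i]^{(k)} = [E_i]^k/[k]_v!. -/

import Mathlib

open Finset Module Classical

universe u

/-- A representation of the quiver with vertex set `I` and `c i j` arrows from `i` to `j`
(loops counted by `c i i`), over a field `k`. -/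
structure QRep (k : Type) [Field k] {I : Type} (c : I → I → ℕ) where
  V : I → Type
  [grp : ∀ i, AddCommGroup (V i)]
  [mod : ∀ i, Module k (V i)]
  [fd : ∀ i, FiniteDimensional k (V i)]
  x : ∀ i j, Fin (c i j) → (V i →ₗ[k] V j)

attribute [instance] QRep.grp QRep.mod QRep.fd

variable {k : Type} [Field k] [Fintype k] {I : Type} [Fintype I] [DecidableEq I] {c : I → I → ℕ}

/-- Isomorphism of representations. -/
def QRepIso (M N : QRep k c) : Prop :=
  ∃ e : ∀ i, M.V i ≃ₗ[k] N.V i, ∀ i j a m, e j (M.x i j a m) = N.x i j a (e i m)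

/-- A subrepresentation of `L`. -/
structure QSubRep (L : QRep k c) where
  W : ∀ i, Submodule k (L.V i)
  stable : ∀ i j a, ∀ w ∈ W i, L.x i j a w ∈ W j

/-- The subrepresentation as a representation. -/
def QSubRep.toRep {L : QRep k c} (X : QSubRep L) : QRep k c where
  V i := X.W i
  x i j a := (L.x i j a).restrict (X.stable i j a)

/-- The quotient representation `L/X`. -/
def QSubRep.quotRep {L : QRep k c} (X : QSubRep L) : QRep k c where
  V i := L.V i ⧸ X.W i
  x i j a := Submodule.mapQ (X.W i) (X.W j) (L.x i j a) (fun w hw => X.stable i j a w hw)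

/-- The dimension vector. -/
noncomputable def dimv (M : QRep k c) : I → ℕ := fun i => finrank k (M.V i)

/-- The Euler form `⟨α,β⟩ = ∑_i (1-g_i) d_i d_i' - ∑_{i≠j} c_{ij} d_i d_j'`. -/
def eulerF (c : I → I → ℕ) (d d' : I → ℕ) : ℤ :=
  ∑ i, (1 - (c i i : ℤ)) * d i * d' i
    - ∑ i, ∑ j, (if i = j then 0 else (c i j : ℤ)) * (d i) * (d' j)

/-- The Hall number `α_{M,N}^L = #{X ⊆ L : X ≅ N, L/X ≅ M}`. -/
noncomputable def hallNum (M N L : QRep k c) : ℕ :=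
  Nat.card {X : QSubRep L // QRepIso X.toRep N ∧ QRepIso X.quotRep M}

/-- The coefficient of `[L]` in the twisted Hall product `[M][N]`. -/
noncomputable def prodCoeff (v : ℝ) (M N L : QRep k c) : ℝ :=
  v ^ (eulerF c (dimv M) (dimv N)) * hallNum M N L

/-- The representation `E_{i,l}`: `k^l` at vertex `i`, zero elsewhere, all maps zero. -/
def ERep (i : I) (l : ℕ) : QRep k c where
  V j := Fin (if j = i then l else 0) → k
  x _ _ _ := 0

/-- Direct sum of representations. -/
def dsum (M N : QRep k c) : QRep k c where
  V i := M.V i × N.V i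
  x i j a := (M.x i j a).prodMap (N.x i j a)

/-- Isomorphism is an equivalence relation. -/
instance repSetoid (k : Type) [Field k] {I : Type} (c : I → I → ℕ) [Field k] : Setoid (QRep k c) :=
  ⟨QRepIso, by
    constructor
    · exact fun M => ⟨fun i => LinearEquiv.refl k (M.V i), fun _ _ _ _ => rfl⟩
    · rintro M N ⟨e, he⟩
      exact ⟨fun i => (e i).symm, by
        intro i j a m
        apply (e j).injective
        simp [he i j a ((e i).symm m)]⟩
    · rintro M N P ⟨e, he⟩ ⟨f, hf⟩
      exact ⟨fun i => (e i).trans (f i), by intro i j a m; simp [he, hf]⟩⟩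

/-- Isomorphism classes of representations. -/
def QRepCl (k : Type) [Field k] {I : Type} (c : I → I → ℕ) : Type 1 :=
  Quotient (repSetoid k c)

/-- The basis element `[M]` of the Hall algebra, as a coefficient function on
isomorphism classes. -/
noncomputable def hbasis (M : QRep k c) : QRepCl k c → ℝ :=
  fun L => if L = ⟦M⟧ then 1 else 0

/-- The twisted Hall multiplication, extended bilinearly to coefficient functions. -/
noncomputable def hmul (v : ℝ) (f g : QRepCl k c → ℝ) : QRepCl k c → ℝ :=
  fun L => ∑ᶠ p : QRepCl k c × QRepCl k c,
    f p.1 * g p.2 * prodCoeff v p.1.out p.2.out L.out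

/-- The zero representation. -/
def zeroRep : QRep k c where
  V _ := Fin 0 → k
  x _ _ _ := 0

/-- Powers in the Hall algebra. -/
noncomputable def hpow (v : ℝ) (f : QRepCl k c → ℝ) : ℕ → (QRepCl k c → ℝ)
  | 0 => hbasis zeroRep
  | n + 1 => hmul v f (hpow v f n)

/-- Balanced quantum integer. -/
noncomputable def qint (v : ℝ) (n : ℕ) : ℝ := (v ^ n - v⁻¹ ^ n) / (v - v⁻¹)

/-- Balanced quantum factorial. -/
noncomputable def qfact (v : ℝ) (l : ℕ) : ℝ := ∏ j ∈ Finset.range l, qint v (j + 1)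

/-- Order of the automorphism group of a representation. -/
noncomputable def autNum (M : QRep k c) : ℕ :=
  Nat.card {e : ∀ i, M.V i ≃ₗ[k] M.V i // ∀ i j a m, e j (M.x i j a m) = M.x i j a (e i m)}

/-- The Gaussian binomial coefficient, defined by the `q`-Pascal recursion. -/
def gaussBinom (q : ℝ) : ℕ → ℕ → ℝ
  | _, 0 => 1
  | 0, _ + 1 => 0
  | n + 1, d + 1 => gaussBinom q n d + q ^ (d + 1) * gaussBinom q n (d + 1)

theorem gaussBinom_zero_right (q : ℝ) (n : ℕ) : gaussBinom q n 0 = 1 := by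
  cases n <;> rfl

theorem gaussBinom_eq_zero_of_lt (q : ℝ) {n d : ℕ} (h : n < d) : gaussBinom q n d = 0 := by
  induction n generalizing d with
  | zero => obtain ⟨d, rfl⟩ := Nat.exists_eq_add_of_lt h; rw [Nat.zero_add]; rfl
  | succ n ih =>
    obtain ⟨d, rfl⟩ := Nat.exists_eq_succ_of_ne_zero (Nat.ne_zero_of_lt h)
    simp [gaussBinom, ih (d := d) (by omega), ih (d := d + 1) (by omega)]

theorem gaussBinom_self (q : ℝ) (n : ℕ) : gaussBinom q n n = 1 := by
  induction n with
  | zero => rfl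
  | succ n ih => simp [gaussBinom, ih, gaussBinom_eq_zero_of_lt q (Nat.lt_succ_self n)]

theorem gaussBinom_succ_self_mul (q : ℝ) (n : ℕ) :
    gaussBinom q (n + 1) n * (q - 1) = q ^ (n + 1) - 1 := by
  induction n with
  | zero => simp [gaussBinom]
  | succ n ih =>
    rw [gaussBinom, gaussBinom_self, add_mul, ih]
    ring

theorem prod_pow_succ_sub_pow (q : ℝ) (n d : ℕ) :
    ∏ i ∈ range (d + 1), (q ^ (n + 1) - q ^ i)
      = (q ^ (n + 1) - 1) * q ^ d * ∏ i ∈ range d, (q ^ n - q ^ i) := by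
  rw [prod_range_succ', mul_comm, pow_zero, mul_assoc]
  congr 1
  calc ∏ i ∈ range d, (q ^ (n + 1) - q ^ (i + 1)) = ∏ i ∈ range d, q * (q ^ n - q ^ i) :=
        prod_congr rfl fun i _ => by ring
    _ = _ := by rw [prod_mul_distrib, prod_const, card_range]

theorem gaussBinom_mul_prod (q : ℝ) (n d : ℕ) :
    gaussBinom q n d * ∏ i ∈ range d, (q ^ d - q ^ i) = ∏ i ∈ range d, (q ^ n - q ^ i) := by
  induction n generalizing d with
  | zero =>
    cases d with
    | zero => simp [gaussBinom]
    | succ d =>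
      rw [gaussBinom_eq_zero_of_lt q (Nat.succ_pos d), zero_mul, eq_comm]
      exact prod_eq_zero (mem_range.2 (Nat.succ_pos d)) (by simp)
  | succ n ih =>
    cases d with
    | zero => simp [gaussBinom_zero_right]
    | succ d =>
      rw [gaussBinom, add_mul, mul_assoc (q ^ (d + 1)), ih (d + 1), prod_pow_succ_sub_pow,
        prod_pow_succ_sub_pow, mul_left_comm, ih d, prod_range_succ]
      ring

/-- The `q`-binomial theorem. -/
theorem sum_gaussBinom (q z : ℝ) (n : ℕ) :
    ∑ d ∈ range (n + 1), (-1) ^ d * q ^ (d.choose 2) * z ^ d * gaussBinom q n d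
      = ∏ a ∈ range n, (1 - z * q ^ a) := by
  induction n generalizing z with
  | zero => simp [gaussBinom]
  | succ n ih =>
    have hs : ∏ a ∈ range (n + 1), (1 - z * q ^ a)
        = (1 - z) * ∏ a ∈ range n, (1 - z * q * q ^ a) := by
      rw [prod_range_succ', mul_comm, pow_zero, mul_one]
      congr 1
      exact prod_congr rfl fun a _ => by ring
    have htop : ∑ d ∈ range (n + 1), (-1) ^ d * q ^ (d.choose 2) * (z * q) ^ d * gaussBinom q n d
        = ∑ d ∈ range (n + 1), (-1) ^ (d + 1) * q ^ ((d + 1).choose 2) * (z * q) ^ (d + 1)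
            * gaussBinom q n (d + 1) + 1 := by
      rw [sum_range_succ', sum_range_succ, gaussBinom_eq_zero_of_lt q (Nat.lt_succ_self n)]
      simp [gaussBinom_zero_right]
    rw [hs, ← ih (z * q), sub_mul, one_mul]
    nth_rw 1 [htop]
    rw [sum_range_succ', mul_sum, add_sub_right_comm, ← sum_sub_distrib]
    congr 1
    · refine sum_congr rfl fun d _ => ?_
      rw [gaussBinom, Nat.choose_succ_succ' d 1, Nat.choose_one_right]
      ring
    · simp [gaussBinom_zero_right]

theorem card_submodule_finrank_mul {V : Type} [AddCommGroup V] [Module k V]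
    [FiniteDimensional k V] (d : ℕ) :
    (Nat.card {W : Submodule k V // finrank k W = d} : ℝ)
        * ∏ i ∈ range d, ((Fintype.card k : ℝ) ^ d - (Fintype.card k : ℝ) ^ i)
      = ∏ i ∈ range d, ((Fintype.card k : ℝ) ^ finrank k V - (Fintype.card k : ℝ) ^ i) := by
  have : Finite V := Module.finite_of_finite k
  have hq : 1 ≤ Fintype.card k := Fintype.card_pos
  have hcard : ∀ (U : Type) [AddCommGroup U] [Module k U] [Finite U], d ≤ finrank k U →
      (Nat.card {s : Fin d → U // LinearIndependent k s} : ℝ)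
        = ∏ i ∈ range d, ((Fintype.card k : ℝ) ^ finrank k U - (Fintype.card k : ℝ) ^ i) := by
    intro U _ _ _ h
    rw [card_linearIndependent h, Nat.cast_prod, ← Fin.prod_univ_eq_prod_range
      (fun i => (Fintype.card k : ℝ) ^ finrank k U - (Fintype.card k : ℝ) ^ i)]
    refine prod_congr rfl fun i _ => ?_
    rw [Nat.cast_sub (Nat.pow_le_pow_right hq (i.2.le.trans h))]
    push_cast
    rfl
  by_cases hd : d ≤ finrank k V
  · rw [← hcard V hd]
    let e : {s : Fin d → V // LinearIndependent k s} ≃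
        Σ W : {W : Submodule k V // finrank k W = d},
          {s : Fin d → W.1 // LinearIndependent k s} :=
      { toFun := fun s => ⟨⟨Submodule.span k (Set.range s.1), by
            rw [finrank_span_eq_card s.2, Fintype.card_fin]⟩,
          ⟨fun a => ⟨s.1 a, Submodule.subset_span ⟨a, rfl⟩⟩,
            LinearIndependent.of_comp (Submodule.subtype _) s.2⟩⟩
        invFun := fun p => ⟨fun a => (p.2.1 a : V),
          p.2.2.map' (Submodule.subtype _) (Submodule.ker_subtype _)⟩
        left_inv := fun s => rfl
        right_inv := by
          rintro ⟨⟨W, hW⟩, ⟨s, hs⟩⟩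
          obtain ⟨t, ht, rfl⟩ : ∃ (t : Fin d → V) (ht : ∀ a, t a ∈ W), s = fun a => ⟨t a, ht a⟩ :=
            ⟨fun a => (s a : V), fun a => (s a).2, rfl⟩
          have hli : LinearIndependent k t :=
            hs.map' (Submodule.subtype _) (Submodule.ker_subtype _)
          have hspan : Submodule.span k (Set.range t) = W := by
            apply Submodule.eq_of_le_of_finrank_eq
            · rw [Submodule.span_le]
              rintro _ ⟨a, rfl⟩
              exact ht a
            · rw [finrank_span_eq_card hli, Fintype.card_fin, hW]
          subst hspan
          rfl }
    have : Fintype {W : Submodule k V // finrank k W = d} := Fintype.ofFinite _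
    rw [Nat.card_congr e, Nat.card_sigma, Nat.cast_sum, Nat.card_eq_fintype_card,
      ← Finset.card_univ, ← nsmul_eq_mul, ← Finset.sum_const]
    refine sum_congr rfl fun W _ => ?_
    rw [hcard W.1 W.2.ge, W.2]
  · have : IsEmpty {W : Submodule k V // finrank k W = d} :=
      ⟨fun W => hd (W.2 ▸ Submodule.finrank_le W.1)⟩
    rw [Nat.card_of_isEmpty, Nat.cast_zero, zero_mul, eq_comm]
    exact prod_eq_zero (mem_range.2 (not_le.1 hd)) (sub_self _)

/-- The number of subspaces of given dimension is a Gaussian binomial coefficient. -/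
theorem card_submodule_finrank {V : Type} [AddCommGroup V] [Module k V]
    [FiniteDimensional k V] (d : ℕ) :
    (Nat.card {W : Submodule k V // finrank k W = d} : ℝ)
      = gaussBinom (Fintype.card k) (finrank k V) d := by
  have hq : (1 : ℝ) < Fintype.card k := by exact_mod_cast Fintype.one_lt_card
  refine mul_right_cancel₀ (prod_ne_zero_iff.2 fun i hi => ?_)
    ((card_submodule_finrank_mul d).trans (gaussBinom_mul_prod _ _ d).symm)
  exact sub_ne_zero.2 (pow_right_strictMono₀ hq (mem_range.1 hi)).ne'

/-- The number of subspaces of given dimension between two nested subspaces. -/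
theorem card_submodule_between {V : Type} [AddCommGroup V] [Module k V]
    [FiniteDimensional k V] {R K : Submodule k V} (hRK : R ≤ K) (d : ℕ) :
    (Nat.card {W : Submodule k V // finrank k W = finrank k R + d ∧ R ≤ W ∧ W ≤ K} : ℝ)
      = gaussBinom (Fintype.card k) (finrank k K - finrank k R) d := by
  let R' : Submodule k K := R.comap K.subtype
  have hR' : finrank k R' = finrank k R := (Submodule.comapSubtypeEquivOfLe hRK).finrank_eq
  have hfin : ∀ U : Submodule k (K ⧸ R'),
      finrank k ((U.comap R'.mkQ).map K.subtype) = finrank k R + finrank k U := by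
    intro U
    rw [Submodule.finrank_map_subtype_eq]
    have h1 := LinearMap.finrank_range_add_finrank_ker (R'.mkQ.domRestrict (U.comap R'.mkQ))
    have h2 : LinearMap.range (R'.mkQ.domRestrict (U.comap R'.mkQ)) = U := by
      rw [LinearMap.range_domRestrict, Submodule.map_comap_eq_of_surjective R'.mkQ_surjective]
    have h3 : finrank k (LinearMap.ker (R'.mkQ.domRestrict (U.comap R'.mkQ))) = finrank k R := by
      rw [LinearMap.ker_domRestrict, Submodule.ker_mkQ, ← hR']
      refine (Submodule.comapSubtypeEquivOfLe fun x hx => ?_).finrank_eq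
      rw [Submodule.mem_comap, Submodule.mkQ_apply, (Submodule.Quotient.mk_eq_zero R').2 hx]
      exact U.zero_mem
    rw [h2, h3] at h1
    omega
  have hback : ∀ W : Submodule k V, R ≤ W → W ≤ K →
      (((W.comap K.subtype).map R'.mkQ).comap R'.mkQ).map K.subtype = W := by
    intro W h1 h2
    rw [Submodule.comap_map_mkQ, sup_eq_right.2 (Submodule.comap_mono h1),
      Submodule.map_comap_subtype, inf_eq_right.2 h2]
  let e : {U : Submodule k (K ⧸ R') // finrank k U = d} ≃
      {W : Submodule k V // finrank k W = finrank k R + d ∧ R ≤ W ∧ W ≤ K} :=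
    { toFun := fun U => ⟨(U.1.comap R'.mkQ).map K.subtype, by rw [hfin, U.2], by
          rw [← inf_eq_right.2 hRK, ← Submodule.map_comap_subtype]
          exact Submodule.map_mono (Submodule.le_comap_mkQ R' U.1), Submodule.map_subtype_le _ _⟩
      invFun := fun W => ⟨(W.1.comap K.subtype).map R'.mkQ, by
          have h := hfin ((W.1.comap K.subtype).map R'.mkQ)
          rw [hback W.1 W.2.2.1 W.2.2.2, W.2.1] at h
          omega⟩
      left_inv := fun U => Subtype.ext (by
        change Submodule.map R'.mkQ (Submodule.comap K.subtype
          (Submodule.map K.subtype (Submodule.comap R'.mkQ U.1))) = U.1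
        rw [Submodule.comap_map_eq_of_injective K.injective_subtype,
          Submodule.map_comap_eq_of_surjective R'.mkQ_surjective])
      right_inv := fun W => Subtype.ext (hback W.1 W.2.2.1 W.2.2.2) }
  rw [← Nat.card_congr e, card_submodule_finrank, Submodule.finrank_quotient, hR']

set_option linter.unusedSectionVars false

theorem QSubRep.W_injective {L : QRep k c} :
    Function.Injective (QSubRep.W : QSubRep L → ∀ i, Submodule k (L.V i)) := by
  rintro ⟨W, h⟩ ⟨W', h'⟩ rfl
  rfl

instance QSubRep.finite (L : QRep k c) : Finite (QSubRep L) := by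
  have (i : I) : Finite (L.V i) := Module.finite_of_finite k
  have (i : I) : Finite (Submodule k (L.V i)) := Finite.of_injective _ SetLike.coe_injective
  exact Finite.of_injective _ QSubRep.W_injective

/-- The isomorphism class of a representation. -/
def QRep.cl (M : QRep k c) : QRepCl k c := ⟦M⟧

theorem QRep.cl_surjective : Function.Surjective (QRep.cl : QRep k c → QRepCl k c) :=
  Quotient.mk_surjective

theorem cl_eq_cl_iff {M N : QRep k c} : M.cl = N.cl ↔ QRepIso M N := Quotient.eq

theorem QRepIso.refl (M : QRep k c) : QRepIso M M := (repSetoid k c).refl M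

theorem QRepIso.symm {M N : QRep k c} (h : QRepIso M N) : QRepIso N M := (repSetoid k c).symm h

theorem QRepIso.trans {M N P : QRep k c} (h : QRepIso M N) (h' : QRepIso N P) : QRepIso M P :=
  (repSetoid k c).trans h h'

theorem QRepIso.dimv_eq {M N : QRep k c} (h : QRepIso M N) : dimv M = dimv N := by
  obtain ⟨e, -⟩ := h
  exact funext fun i => (e i).finrank_eq

/-- Transport of subrepresentations along an isomorphism. -/
def QSubRep.map {L L' : QRep k c} (e : ∀ i, L.V i ≃ₗ[k] L'.V i)
    (he : ∀ i j a m, e j (L.x i j a m) = L'.x i j a (e i m)) (X : QSubRep L) : QSubRep L' where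
  W i := (X.W i).map (e i).toLinearMap
  stable i j a := by
    rintro _ ⟨w, hw, rfl⟩
    exact ⟨L.x i j a w, X.stable i j a w hw, he i j a w⟩

theorem QSubRep.map_toRep {L L' : QRep k c} (e : ∀ i, L.V i ≃ₗ[k] L'.V i)
    (he : ∀ i j a m, e j (L.x i j a m) = L'.x i j a (e i m)) (X : QSubRep L) :
    QRepIso X.toRep (X.map e he).toRep :=
  ⟨fun i => (e i).submoduleMap (X.W i), fun i j a m => Subtype.ext (he i j a m.1)⟩

theorem QSubRep.map_quotRep {L L' : QRep k c} (e : ∀ i, L.V i ≃ₗ[k] L'.V i)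
    (he : ∀ i j a m, e j (L.x i j a m) = L'.x i j a (e i m)) (X : QSubRep L) :
    QRepIso X.quotRep (X.map e he).quotRep := by
  refine ⟨fun i => Submodule.Quotient.equiv (X.W i) ((X.map e he).W i) (e i) rfl,
    fun i j a m => ?_⟩
  obtain ⟨m, rfl⟩ := Submodule.Quotient.mk_surjective _ m
  exact congrArg (Submodule.Quotient.mk (p := (X.map e he).W j)) (he i j a m)

theorem QSubRep.map_injective {L L' : QRep k c} (e : ∀ i, L.V i ≃ₗ[k] L'.V i)
    (he : ∀ i j a m, e j (L.x i j a m) = L'.x i j a (e i m)) :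
    Function.Injective (QSubRep.map e he) := fun _ _ h =>
  QSubRep.W_injective <| funext fun i =>
    Submodule.map_injective_of_injective (e i).injective (congrFun (congrArg QSubRep.W h) i)

theorem hallNum_le_of_iso {M M' N N' L L' : QRep k c} (hM : QRepIso M M') (hN : QRepIso N N')
    (hL : QRepIso L L') : hallNum M N L ≤ hallNum M' N' L' := by
  obtain ⟨e, he⟩ := hL
  refine Nat.card_le_card_of_injective
    (fun X => ⟨X.1.map e he, (X.1.map_toRep e he).symm.trans (X.2.1.trans hN),
      (X.1.map_quotRep e he).symm.trans (X.2.2.trans hM)⟩) fun X Y h => ?_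
  exact Subtype.ext (QSubRep.map_injective e he (congrArg Subtype.val h))

theorem hallNum_congr {M M' N N' L L' : QRep k c} (hM : QRepIso M M') (hN : QRepIso N N')
    (hL : QRepIso L L') : hallNum M N L = hallNum M' N' L' :=
  (hallNum_le_of_iso hM hN hL).antisymm (hallNum_le_of_iso hM.symm hN.symm hL.symm)

theorem out_iso (M : QRep k c) : QRepIso M.cl.out M :=
  Quotient.mk_out M

/-- The twisted Hall product as a sum over subrepresentations. -/
theorem hmul_cl (v : ℝ) (f g : QRepCl k c → ℝ) (L : QRep k c) :
    hmul v f g L.cl = ∑ᶠ X : QSubRep L, f X.quotRep.cl * g X.toRep.cl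
      * v ^ eulerF c (dimv X.quotRep) (dimv X.toRep) := by
  have : Fintype (QSubRep L) := Fintype.ofFinite _
  let Φ : QSubRep L → QRepCl k c × QRepCl k c := fun X => (X.quotRep.cl, X.toRep.cl)
  let h : QRepCl k c × QRepCl k c → ℝ := fun p =>
    f p.1 * g p.2 * v ^ eulerF c (dimv p.1.out) (dimv p.2.out)
  have hcard : ∀ p : QRepCl k c × QRepCl k c,
      hallNum p.1.out p.2.out L.cl.out = #{X : QSubRep L | Φ X = p} := by
    rintro ⟨M, N⟩
    rw [hallNum_congr (QRepIso.refl _) (QRepIso.refl _) (out_iso L), hallNum,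
      Nat.card_eq_fintype_card, Fintype.card_subtype]
    congr 1
    ext X
    have hout (P : QRepCl k c) : P.out.cl = P := Quotient.out_eq P
    rw [mem_filter_univ, mem_filter_univ, and_comm, Prod.ext_iff, ← cl_eq_cl_iff, ← cl_eq_cl_iff,
      hout, hout]
  have hterm : ∀ p : QRepCl k c × QRepCl k c,
      f p.1 * g p.2 * prodCoeff v p.1.out p.2.out L.cl.out
        = #{X : QSubRep L | Φ X = p} • h p := by
    intro p
    rw [prodCoeff, hcard, nsmul_eq_mul]
    simp only [h]
    ring
  have hX : ∀ X : QSubRep L, f X.quotRep.cl * g X.toRep.cl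
      * v ^ eulerF c (dimv X.quotRep) (dimv X.toRep) = h (Φ X) := fun X => by
    simp only [h, Φ]
    rw [(out_iso X.quotRep).dimv_eq, (out_iso X.toRep).dimv_eq]
  rw [finsum_eq_sum_of_fintype, sum_congr rfl fun X _ => hX X, sum_comp h Φ]
  refine (finsum_congr hterm).trans ?_
  refine finsum_eq_sum_of_support_subset _ fun p hp => ?_
  obtain ⟨X, hX⟩ := card_ne_zero.1 (left_ne_zero_of_smul hp)
  exact mem_coe.2 (mem_image.2 ⟨X, mem_univ _, (mem_filter.1 hX).2⟩)

theorem hbasis_cl (M N : QRep k c) : hbasis M N.cl = if QRepIso N M then 1 else 0 := by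
  exact if_congr cl_eq_cl_iff rfl rfl

theorem hmul_smul_smul (v a b : ℝ) (f g : QRepCl k c → ℝ) :
    hmul v (a • f) (b • g) = (a * b) • hmul v f g := by
  ext L
  obtain ⟨L, rfl⟩ := QRep.cl_surjective L
  rw [Pi.smul_apply, hmul_cl, hmul_cl, smul_finsum]
  refine finsum_congr fun X => ?_
  simp only [Pi.smul_apply, smul_eq_mul]
  ring

/-- The Hall product of a basis element with the indicator function of a set of
representations of fixed dimension vector. -/
theorem hmul_hbasis_cl (v : ℝ) (M : QRep k c) (g : QRepCl k c → ℝ) (P : QRep k c → Prop)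
    (d : I → ℕ) (hd : ∀ N, P N → dimv N = d) (hg : ∀ N, g N.cl = if P N then 1 else 0)
    (L : QRep k c) :
    hmul v (hbasis M) g L.cl
      = v ^ eulerF c (dimv M) d * Nat.card {X : QSubRep L // P X.toRep ∧ QRepIso X.quotRep M} := by
  have : Fintype (QSubRep L) := Fintype.ofFinite _
  rw [hmul_cl, finsum_eq_sum_of_fintype, Nat.card_eq_fintype_card, Fintype.card_subtype,
    mul_comm, ← nsmul_eq_mul, ← sum_const, sum_filter]
  refine sum_congr rfl fun X _ => ?_
  rw [hg, hbasis_cl]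
  by_cases h1 : QRepIso X.quotRep M
  · by_cases h2 : P X.toRep
    · simp [h1, h2, hd _ h2, h1.dimv_eq]
    · simp [h2]
  · simp [h1]

theorem x_eq_zero_of_source {M : QRep k c} {a b : I} (h : dimv M a = 0) (s : Fin (c a b)) :
    M.x a b s = 0 := by
  have := finrank_zero_iff.1 h
  exact Subsingleton.elim _ _

theorem x_eq_zero_of_target {M : QRep k c} {a b : I} (h : dimv M b = 0) (s : Fin (c a b)) :
    M.x a b s = 0 := by
  have := finrank_zero_iff.1 h
  exact LinearMap.ext fun m => Subsingleton.elim _ _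

theorem dimv_ERep (i : I) (l : ℕ) : dimv (ERep i l : QRep k c) = Pi.single i l := by
  ext m
  rw [Pi.single_apply]
  exact (finrank_fintype_fun_eq_card k).trans (Fintype.card_fin _)

theorem qRepIso_ERep_iff {M : QRep k c} {i : I} {l : ℕ} :
    QRepIso M (ERep i l) ↔ dimv M = Pi.single i l ∧ ∀ s, M.x i i s = 0 := by
  constructor
  · intro h
    refine ⟨h.dimv_eq.trans (dimv_ERep i l), fun s => ?_⟩
    obtain ⟨e, he⟩ := h
    exact LinearMap.ext fun m => (e i).injective ((he i i s m).trans (map_zero (e i)).symm)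
  · rintro ⟨h1, h2⟩
    have hfin : ∀ m, finrank k (M.V m) = finrank k ((ERep i l : QRep k c).V m) := fun m =>
      congrFun (h1.trans (dimv_ERep i l).symm) m
    refine ⟨fun m => LinearEquiv.ofFinrankEq _ _ (hfin m), fun a b s m => ?_⟩
    have h0 : M.x a b s = 0 := by
      by_cases ha : a = i
      · subst ha
        by_cases hb : b = a
        · subst hb
          exact h2 s
        · exact x_eq_zero_of_target (by rw [h1, Pi.single_eq_of_ne hb]) s
      · exact x_eq_zero_of_source (by rw [h1, Pi.single_eq_of_ne ha]) s
    rw [h0, LinearMap.zero_apply, map_zero]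
    rfl

theorem qRepIso_ERep_iff_of_loopless {M : QRep k c} {i : I} {l : ℕ} (hi : c i i = 0) :
    QRepIso M (ERep i l) ↔ dimv M = Pi.single i l := by
  rw [qRepIso_ERep_iff, and_iff_left]
  intro s
  exact absurd s.2 (by omega)

theorem dimv_quotRep_add_dimv_toRep {L : QRep k c} (X : QSubRep L) :
    dimv X.quotRep + dimv X.toRep = dimv L :=
  funext fun i => (X.W i).finrank_quotient_add_finrank

theorem QSubRep.eq_top_of_dimv_quotRep {L : QRep k c} (X : QSubRep L) {m : I}
    (h : dimv X.quotRep m = 0) : X.W m = ⊤ := by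
  have : Subsingleton (X.quotRep.V m) := finrank_zero_iff.1 h
  exact Submodule.Quotient.subsingleton_iff.1 this

theorem QSubRep.eq_bot_of_dimv_toRep {L : QRep k c} (X : QSubRep L) {m : I}
    (h : dimv X.toRep m = 0) : X.W m = ⊥ :=
  Submodule.finrank_eq_zero.1 h

/-- The subrepresentation that is everything except at a loop-free vertex `i`. -/
noncomputable def QSubRep.ofVertex {L : QRep k c} {i : I} (hi : c i i = 0)
    (W : Submodule k (L.V i)) (hW : ∀ a s, a ≠ i → ∀ m, L.x a i s m ∈ W) : QSubRep L where
  W := Function.update (fun _ => ⊤) i W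
  stable a b s w _ := by
    by_cases hb : b = i
    · subst hb
      rw [Function.update_self]
      refine hW a s (fun ha => ?_) w
      subst ha
      exact absurd s.2 (by omega)
    · rw [Function.update_of_ne hb]
      trivial

theorem QSubRep.ofVertex_W {L : QRep k c} {i : I} (hi : c i i = 0)
    (W : Submodule k (L.V i)) (hW : ∀ a s, a ≠ i → ∀ m, L.x a i s m ∈ W) :
    (QSubRep.ofVertex hi W hW).W i = W :=
  Function.update_self (β := fun m => Submodule k (L.V m)) i W (fun _ => ⊤)

theorem QSubRep.ofVertex_W_of_ne {L : QRep k c} {i : I} (hi : c i i = 0)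
    (W : Submodule k (L.V i)) (hW : ∀ a s, a ≠ i → ∀ m, L.x a i s m ∈ W) {m : I} (hm : m ≠ i) :
    (QSubRep.ofVertex hi W hW).W m = ⊤ :=
  Function.update_of_ne (β := fun m => Submodule k (L.V m)) hm W (fun _ => ⊤)

theorem QSubRep.dimv_ofVertex {L : QRep k c} {i : I} (hi : c i i = 0)
    (W : Submodule k (L.V i)) (hW : ∀ a s, a ≠ i → ∀ m, L.x a i s m ∈ W) :
    dimv (QSubRep.ofVertex hi W hW).toRep = Function.update (dimv L) i (finrank k W) := by
  ext m
  by_cases hm : m = i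
  · subst hm
    rw [Function.update_self]
    change finrank k ((QSubRep.ofVertex hi W hW).W m) = _
    rw [QSubRep.ofVertex_W]
  · rw [Function.update_of_ne hm]
    change finrank k ((QSubRep.ofVertex hi W hW).W m) = _
    rw [QSubRep.ofVertex_W_of_ne hi W hW hm, finrank_top]
    rfl

/-- A subrepresentation with quotient supported at `i` is determined by its `i`-component. -/
theorem QSubRep.ext_of_quotRep {L : QRep k c} {i : I} {t t' : ℕ} {X Y : QSubRep L}
    (hX : dimv X.quotRep = Pi.single i t) (hY : dimv Y.quotRep = Pi.single i t')
    (h : X.W i = Y.W i) : X = Y := by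
  refine QSubRep.W_injective (funext fun m => ?_)
  by_cases hm : m = i
  · subst hm
    exact h
  · rw [X.eq_top_of_dimv_quotRep (by rw [hX, Pi.single_eq_of_ne hm]),
      Y.eq_top_of_dimv_quotRep (by rw [hY, Pi.single_eq_of_ne hm])]

theorem eulerF_add_right (d d₁ d₂ : I → ℕ) :
    eulerF c d (d₁ + d₂) = eulerF c d d₁ + eulerF c d d₂ := by
  simp only [eulerF, Pi.add_apply, Nat.cast_add, mul_add, sum_add_distrib]
  ring

theorem eulerF_single_single (i j : I) (a b : ℕ) :
    eulerF c (Pi.single i a) (Pi.single j b)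
      = ((if i = j then 1 else 0) - (c i j : ℤ)) * a * b := by
  have h (m n : I) (a : ℕ) : ((Pi.single m a : I → ℕ) n : ℤ) = if n = m then (a : ℤ) else 0 := by
    rw [Pi.single_apply]
    split_ifs <;> simp
  simp only [eulerF, h]
  simp only [mul_ite, mul_zero, ite_mul, zero_mul, sum_ite_eq', mem_univ, if_true]
  by_cases hij : i = j
  · subst hij
    simp
  · simp [hij, Ne.symm hij]

theorem finrank_iSup_range_le {ι U V : Type} [Fintype ι] [AddCommGroup U] [Module k U]
    [FiniteDimensional k U] [AddCommGroup V] [Module k V] [FiniteDimensional k V]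
    (f : ι → U →ₗ[k] V) :
    finrank k (⨆ a, LinearMap.range (f a) : Submodule k V) ≤ Fintype.card ι * finrank k U := by
  have h : (⨆ a, LinearMap.range (f a) : Submodule k V)
      ≤ LinearMap.range (LinearMap.lsum k (fun _ : ι => U) ℕ f) := by
    refine iSup_le fun a => ?_
    rintro _ ⟨u, rfl⟩
    exact ⟨Pi.single a u, LinearMap.lsum_piSingle ..⟩
  refine (Submodule.finrank_mono h).trans ((LinearMap.finrank_range_le _).trans ?_)
  rw [finrank_pi_fintype, sum_const, smul_eq_mul, Finset.card_univ]

theorem finrank_le_finrank_iInf_ker_add {ι U V : Type} [Fintype ι] [AddCommGroup U] [Module k U]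
    [FiniteDimensional k U] [AddCommGroup V] [Module k V] [FiniteDimensional k V]
    (f : ι → V →ₗ[k] U) :
    finrank k V
      ≤ finrank k (⨅ a, LinearMap.ker (f a) : Submodule k V) + Fintype.card ι * finrank k U := by
  have h := LinearMap.finrank_range_add_finrank_ker (LinearMap.pi f)
  have h' := Submodule.finrank_le (LinearMap.range (LinearMap.pi f))
  rw [finrank_pi_fintype, sum_const, smul_eq_mul, Finset.card_univ] at h'
  rw [LinearMap.ker_pi] at h
  omega

theorem hallNum_ERep_one_ERep {i : I} (hi : c i i = 0) (t : ℕ) (L : QRep k c) :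
    (hallNum (ERep i 1) (ERep i t) L : ℝ)
      = if dimv L = Pi.single i (t + 1) then gaussBinom (Fintype.card k) (t + 1) t else 0 := by
  simp only [hallNum, qRepIso_ERep_iff_of_loopless hi]
  split_ifs with hL
  · have hLi : finrank k (L.V i) = t + 1 := (congrFun hL i).trans (Pi.single_eq_same ..)
    rw [← hLi, ← card_submodule_finrank]
    congr 1
    refine Nat.card_eq_of_bijective (fun X => ⟨X.1.W i, ?_⟩) ⟨?_, ?_⟩
    · exact (congrFun X.2.1 i).trans (Pi.single_eq_same ..)
    · intro X Y h
      exact Subtype.ext (QSubRep.ext_of_quotRep X.2.2 Y.2.2 (congrArg Subtype.val h))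
    · rintro ⟨W, hW⟩
      have hst : ∀ a s, a ≠ i → ∀ m, L.x a i s m ∈ W := fun a s ha m => by
        rw [x_eq_zero_of_source (by rw [hL, Pi.single_eq_of_ne ha]), LinearMap.zero_apply]
        exact W.zero_mem
      have hsub : dimv (QSubRep.ofVertex hi W hst).toRep = Pi.single i t := by
        rw [QSubRep.dimv_ofVertex, hL, hW, Pi.single, Function.update_idem]
        rfl
      refine ⟨⟨QSubRep.ofVertex hi W hst, hsub, ?_⟩, Subtype.ext (QSubRep.ofVertex_W hi W hst)⟩
      have h := dimv_quotRep_add_dimv_toRep (QSubRep.ofVertex hi W hst)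
      rw [hsub, hL, add_comm t 1, Pi.single_add] at h
      exact add_right_cancel h
  · have : IsEmpty {X : QSubRep L // dimv X.toRep = Pi.single i t ∧
        dimv X.quotRep = Pi.single i 1} := ⟨fun X => hL (by
      rw [← dimv_quotRep_add_dimv_toRep X.1, X.2.1, X.2.2, ← Pi.single_add, add_comm])⟩
    rw [Nat.card_of_isEmpty, Nat.cast_zero]

theorem gaussBinom_succ_self_eq_qint {v : ℝ} (hv : 1 < v) (t : ℕ) :
    gaussBinom (v ^ 2) (t + 1) t = v ^ t * qint v (t + 1) := by
  have h0 : v ≠ 0 := by positivity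
  have h1 : v ^ 2 - 1 ≠ 0 := by nlinarith
  have h2 : v - v⁻¹ ≠ 0 := by
    have : v - v⁻¹ = (v ^ 2 - 1) / v := by field_simp
    rw [this]
    exact div_ne_zero h1 h0
  refine mul_right_cancel₀ h1 ((gaussBinom_succ_self_mul _ _).trans ?_)
  have h3 : v ^ 2 - 1 = v * (v - v⁻¹) := by field_simp
  rw [qint, h3, mul_assoc, div_mul_eq_mul_div, mul_div_assoc, mul_div_assoc, div_self h2, inv_pow]
  field_simp
  ring

theorem hpow_ERep_one {v : ℝ} (hv : 1 < v) (hvq : v ^ 2 = Fintype.card k) {i : I}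
    (hi : c i i = 0) (t : ℕ) :
    hpow v (hbasis (ERep i 1 : QRep k c)) t
      = (v ^ ((t : ℤ) * (t - 1)) * qfact v t) • hbasis (ERep i t : QRep k c) := by
  have h0 : v ≠ 0 := by positivity
  induction t with
  | zero =>
    ext L
    obtain ⟨L, rfl⟩ := QRep.cl_surjective L
    have h : QRepIso (zeroRep : QRep k c) (ERep i 0) := by
      rw [qRepIso_ERep_iff_of_loopless hi, Pi.single_zero]
      exact funext fun m => finrank_fin_fun k
    have h' : QRepIso L zeroRep ↔ QRepIso L (ERep i 0) :=
      ⟨fun e => e.trans h, fun e => e.trans h.symm⟩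
    simp [hpow, qfact, hbasis_cl, h']
  | succ t ih =>
    have key : hmul v (hbasis (ERep i 1 : QRep k c)) (hbasis (ERep i t))
        = (v ^ t * (v ^ t * qint v (t + 1))) • hbasis (ERep i (t + 1)) := by
      ext L
      obtain ⟨L, rfl⟩ := QRep.cl_surjective L
      rw [hmul_hbasis_cl v _ _ (fun N => QRepIso N (ERep i t)) (Pi.single i t)
        (fun N h => h.dimv_eq.trans (dimv_ERep i t)) (hbasis_cl _) L, Pi.smul_apply, hbasis_cl]
      have hn := hallNum_ERep_one_ERep hi t L
      rw [hallNum] at hn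
      rw [hn, dimv_ERep, eulerF_single_single, hi, ← hvq, gaussBinom_succ_self_eq_qint hv,
        if_congr (qRepIso_ERep_iff_of_loopless hi) rfl rfl]
      simp
    rw [hpow, ih, ← one_smul ℝ (hbasis (ERep i 1 : QRep k c)), hmul_smul_smul, key, smul_smul,
      one_mul]
    congr 1
    have : v ^ (((t + 1 : ℕ) : ℤ) * ((t + 1 : ℕ) - 1)) = v ^ ((t : ℤ) * (t - 1)) * v ^ t * v ^ t := by
      rw [← zpow_natCast v t, ← zpow_add₀ h0, ← zpow_add₀ h0]
      congr 1
      push_cast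
      ring
    have hq : qfact v (t + 1) = qfact v t * qint v (t + 1) := prod_range_succ ..
    rw [this, hq]
    ring

/-- Representations with sub `E_{i,s}` and quotient `E_{j,l}`. -/
def IsExtension (i j : I) (l s : ℕ) (Y : QRep k c) : Prop :=
  dimv Y = Pi.single j l + Pi.single i s ∧ (∀ x, Y.x j j x = 0) ∧ ∀ x, Y.x i j x = 0

theorem card_subRep_isExtension {i j : I} (hi : c i i = 0) (hij : i ≠ j) (l s : ℕ)
    (Y : QRep k c) :
    Nat.card {X : QSubRep Y // QRepIso X.toRep (ERep i s) ∧ QRepIso X.quotRep (ERep j l)}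
      = if IsExtension i j l s Y then 1 else 0 := by
  simp only [qRepIso_ERep_iff_of_loopless hi, qRepIso_ERep_iff]
  have hbot : ∀ X : QSubRep Y, dimv X.toRep = Pi.single i s → ∀ m, m ≠ i → X.W m = ⊥ :=
    fun X hX m hm => X.eq_bot_of_dimv_toRep (by rw [hX, Pi.single_eq_of_ne hm])
  have htop : ∀ X : QSubRep Y, dimv X.quotRep = Pi.single j l → X.W i = ⊤ :=
    fun X hX => X.eq_top_of_dimv_quotRep (by rw [hX, Pi.single_eq_of_ne hij])
  split_ifs with hY
  · obtain ⟨hd, hjj, hx⟩ := hY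
    have hYi : dimv Y i = s := by simp [hd, hij]
    let X : QSubRep Y :=
      { W := Function.update (fun _ => ⊥) i ⊤
        stable := by
          intro a b x w hw
          by_cases ha : a = i
          · subst ha
            by_cases hb : b = a
            · subst hb
              exact absurd x.2 (by omega)
            · have h0 : Y.x a b x = 0 := by
                by_cases hbj : b = j
                · subst hbj
                  exact hx x
                · exact x_eq_zero_of_target (by simp [hd, hb, hbj]) x
              rw [h0]
              exact Submodule.zero_mem _
          · rw [Function.update_of_ne ha, Submodule.mem_bot] at hw
            rw [hw, map_zero]
            exact Submodule.zero_mem _ }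
    have hWi : X.W i = ⊤ :=
      Function.update_self (β := fun m => Submodule k (Y.V m)) i ⊤ (fun _ => ⊥)
    have hWm : ∀ m, m ≠ i → X.W m = ⊥ := fun m hm =>
      Function.update_of_ne (β := fun m => Submodule k (Y.V m)) hm ⊤ (fun _ => ⊥)
    have hsub : dimv X.toRep = Pi.single i s := by
      ext m
      change finrank k (X.W m) = _
      by_cases hm : m = i
      · subst hm
        rw [hWi, finrank_top, Pi.single_eq_same]
        exact hYi
      · rw [hWm m hm, finrank_bot, Pi.single_eq_of_ne hm]
    have hquot : dimv X.quotRep = Pi.single j l := by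
      have h := dimv_quotRep_add_dimv_toRep X
      rw [hsub, hd] at h
      exact add_right_cancel h
    have hqx : ∀ x, X.quotRep.x j j x = 0 := fun x => LinearMap.ext fun m => by
      obtain ⟨m, rfl⟩ := Submodule.Quotient.mk_surjective _ m
      change Submodule.Quotient.mk (Y.x j j x m) = _
      rw [hjj x]
      rfl
    rw [Nat.card_eq_one_iff_unique]
    refine ⟨⟨fun X₁ X₂ => Subtype.ext (QSubRep.W_injective (funext fun m => ?_))⟩,
      ⟨⟨X, hsub, hquot, hqx⟩⟩⟩
    by_cases hm : m = i
    · subst hm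
      rw [htop _ X₁.2.2.1, htop _ X₂.2.2.1]
    · rw [hbot _ X₁.2.1 m hm, hbot _ X₂.2.1 m hm]
  · have : IsEmpty {X : QSubRep Y // dimv X.toRep = Pi.single i s ∧
        dimv X.quotRep = Pi.single j l ∧ ∀ x, X.quotRep.x j j x = 0} := by
      refine ⟨fun ⟨X, hs, hq, hz⟩ => hY ⟨?_, fun x => LinearMap.ext fun m => ?_,
        fun x => LinearMap.ext fun m => ?_⟩⟩
      · rw [← dimv_quotRep_add_dimv_toRep X, hs, hq]
      · have h := LinearMap.congr_fun (hz x) (Submodule.Quotient.mk m)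
        have h' : Y.x j j x m ∈ X.W j := (Submodule.Quotient.mk_eq_zero _).1 h
        rw [hbot X hs j hij.symm] at h'
        exact h'
      · have h' := X.stable i j x m (by rw [htop X hq]; trivial)
        rw [hbot X hs j hij.symm] at h'
        exact h'
    exact Nat.card_of_isEmpty

theorem hmul_hbasis_ERep_cl (v : ℝ) {i j : I} (hi : c i i = 0) (hij : i ≠ j) (l s : ℕ)
    (Y : QRep k c) :
    hmul v (hbasis (ERep j l : QRep k c)) (hbasis (ERep i s)) Y.cl
      = v ^ (-(c j i : ℤ) * l * s) * if IsExtension i j l s Y then 1 else 0 := by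
  rw [hmul_hbasis_cl v _ _ (fun N => QRepIso N (ERep i s)) (Pi.single i s)
    (fun N h => h.dimv_eq.trans (dimv_ERep i s)) (hbasis_cl _) Y, card_subRep_isExtension hi hij,
    dimv_ERep, eulerF_single_single, if_neg hij.symm, zero_sub]
  push_cast
  rfl

theorem card_subRep_quot_ERep {i j : I} (hi : c i i = 0) (hij : i ≠ j) (l s t : ℕ)
    {L : QRep k c} (hL : dimv L = Pi.single j l + Pi.single i (t + s))
    (hjj : ∀ x, L.x j j x = 0) :
    Nat.card {Y : QSubRep L // IsExtension i j l s Y.toRep ∧ QRepIso Y.quotRep (ERep i t)}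
      = Nat.card {W : Submodule k (L.V i) // finrank k W = s ∧
          (⨆ x, LinearMap.range (L.x j i x)) ≤ W ∧ W ≤ ⨅ x, LinearMap.ker (L.x i j x)} := by
  simp only [qRepIso_ERep_iff_of_loopless hi, iSup_le_iff, le_iInf_iff]
  refine Nat.card_eq_of_bijective (fun Y => ⟨Y.1.W i, ?_, fun x => ?_, fun x => ?_⟩) ⟨?_, ?_⟩
  · have h := congrFun Y.2.1.1 i
    rw [Pi.add_apply, Pi.single_eq_of_ne hij, Pi.single_eq_same, zero_add] at h
    exact h
  · rintro _ ⟨m, rfl⟩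
    refine Y.1.stable j i x m ?_
    rw [Y.1.eq_top_of_dimv_quotRep (by rw [Y.2.2, Pi.single_eq_of_ne hij.symm])]
    trivial
  · exact fun w hw => congrArg Subtype.val (LinearMap.congr_fun (Y.2.1.2.2 x) ⟨w, hw⟩)
  · intro X Y h
    exact Subtype.ext (QSubRep.ext_of_quotRep X.2.2 Y.2.2 (congrArg Subtype.val h))
  · rintro ⟨W, hW, hR, hK⟩
    have hst : ∀ a x, a ≠ i → ∀ m, L.x a i x m ∈ W := fun a x ha m => by
      by_cases haj : a = j
      · subst haj
        exact hR x ⟨m, rfl⟩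
      · rw [x_eq_zero_of_source (by simp [hL, ha, haj]), LinearMap.zero_apply]
        exact W.zero_mem
    have hsub : dimv (QSubRep.ofVertex hi W hst).toRep = Pi.single j l + Pi.single i s := by
      rw [QSubRep.dimv_ofVertex, hL, hW]
      ext m
      by_cases hm : m = i
      · subst hm
        simp [hij]
      · simp [hm]
    refine ⟨⟨QSubRep.ofVertex hi W hst, ⟨hsub, fun x => ?_, fun x => ?_⟩, ?_⟩,
      Subtype.ext (QSubRep.ofVertex_W hi W hst)⟩
    · exact LinearMap.ext fun m => Subtype.ext (LinearMap.congr_fun (hjj x) m.1)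
    · exact LinearMap.ext fun m => Subtype.ext
        (hK x ((QSubRep.ofVertex_W hi W hst).le m.2))
    · have h := dimv_quotRep_add_dimv_toRep (QSubRep.ofVertex hi W hst)
      rw [hsub, hL, Pi.single_add, add_left_comm] at h
      exact add_right_cancel (add_left_cancel h)

theorem isEmpty_subRep_quot_ERep {i j : I} (hij : i ≠ j) (l s t : ℕ)
    {L : QRep k c} (hL : ¬ (dimv L = Pi.single j l + Pi.single i (t + s) ∧ ∀ x, L.x j j x = 0)) :
    IsEmpty {Y : QSubRep L // IsExtension i j l s Y.toRep ∧ QRepIso Y.quotRep (ERep i t)} := by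
  refine ⟨fun ⟨Y, hY, hq⟩ => hL ⟨?_, fun x => LinearMap.ext fun m => ?_⟩⟩
  · rw [← dimv_quotRep_add_dimv_toRep Y, hY.1, hq.dimv_eq, dimv_ERep, Pi.single_add, add_left_comm]
  · have hm : m ∈ Y.W j := by
      rw [Y.eq_top_of_dimv_quotRep (by rw [hq.dimv_eq, dimv_ERep, Pi.single_eq_of_ne hij.symm])]
      trivial
    exact congrArg Subtype.val (LinearMap.congr_fun (hY.2.1 x) ⟨m, hm⟩)

/-- The coefficients of the product `[E_{i,t}][E_{j,l}][E_{i,s}]`. -/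
theorem hmul_hmul_ERep_cl {v : ℝ} (hv : v ≠ 0) {i j : I} (hi : c i i = 0) (hij : i ≠ j)
    (l s t : ℕ) (L : QRep k c) :
    hmul v (hbasis (ERep i t : QRep k c))
        (hmul v (hbasis (ERep j l : QRep k c)) (hbasis (ERep i s))) L.cl
      = v ^ ((t : ℤ) * s - c i j * t * l) * v ^ (-(c j i : ℤ) * l * s)
        * Nat.card {Y : QSubRep L // IsExtension i j l s Y.toRep
            ∧ QRepIso Y.quotRep (ERep i t)} := by
  have he : v ^ (-(c j i : ℤ) * l * s) ≠ 0 := zpow_ne_zero _ hv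
  set g := hmul v (hbasis (ERep j l : QRep k c)) (hbasis (ERep i s)) with hg
  have hind : ∀ N : QRep k c, ((v ^ (-(c j i : ℤ) * l * s))⁻¹ • g) N.cl
      = if IsExtension i j l s N then 1 else 0 := fun N => by
    rw [Pi.smul_apply, hg, hmul_hbasis_ERep_cl v hi hij, smul_eq_mul, inv_mul_cancel_left₀ he]
  have h := congrFun (hmul_smul_smul v 1 (v ^ (-(c j i : ℤ) * l * s))
    (hbasis (ERep i t : QRep k c)) ((v ^ (-(c j i : ℤ) * l * s))⁻¹ • g)) L.cl
  rw [smul_inv_smul₀ he, one_smul, one_mul, Pi.smul_apply,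
    hmul_hbasis_cl v _ _ (IsExtension i j l s) _ (fun N hN => hN.1) hind, dimv_ERep,
    eulerF_add_right, eulerF_single_single, eulerF_single_single, hi, if_neg hij, if_pos rfl] at h
  rw [h, smul_eq_mul, ← mul_assoc, mul_comm (v ^ (-(c j i : ℤ) * l * s))]
  congr 3
  push_cast
  ring

/-- The alternating sum identity behind the quantum Serre relations. -/
theorem serre_sum_eq_zero {v : ℝ} (hv : v ≠ 0) {A B l n r N : ℕ} (hn : n = 1 + l * (A + B))
    (hr : r ≤ l * B) (hN : l * B < N + r) (hNn : N + r ≤ n) (f : ℕ → ℝ)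
    (hf : ∀ s < r, f s = 0) (hf' : ∀ u, f (r + u) = gaussBinom (v ^ 2) N u) :
    ∑ t ∈ range (n + 1), (-1 : ℝ) ^ t * (v ^ ((t : ℤ) * (t - 1))
        * v ^ (((n - t : ℕ) : ℤ) * ((n - t : ℕ) - 1))
        * (v ^ ((t : ℤ) * (n - t : ℕ) - A * t * l) * v ^ (-(B : ℤ) * l * (n - t : ℕ))
          * f (n - t))) = 0 := by
  let e : ℤ → ℤ := fun s => (n - s) * (n - s - 1) + s * (s - 1) + ((n - s) * s - A * (n - s) * l)
    + -B * l * s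
  let F : ℕ → ℝ := fun s => (-1) ^ (n - s) * v ^ e s * f s
  have hF : ∀ t ∈ range (n + 1), (-1 : ℝ) ^ t * (v ^ ((t : ℤ) * (t - 1))
        * v ^ (((n - t : ℕ) : ℤ) * ((n - t : ℕ) - 1))
        * (v ^ ((t : ℤ) * (n - t : ℕ) - A * t * l) * v ^ (-(B : ℤ) * l * (n - t : ℕ))
          * f (n - t))) = F (n + 1 - 1 - t) := by
    intro t ht
    have ht : t ≤ n := Nat.lt_succ_iff.1 (mem_range.1 ht)
    simp only [F, e, Nat.add_sub_cancel, Nat.sub_sub_self ht, Nat.cast_sub ht, sub_sub_cancel,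
      zpow_add₀ hv]
    ring
  rw [sum_congr rfl hF, sum_range_reflect]
  obtain ⟨M, hM⟩ : ∃ M, n + 1 = r + (N + 1 + M) := ⟨n - (N + r), by omega⟩
  obtain ⟨D, hD⟩ : ∃ D, l * B = r + D := ⟨l * B - r, by omega⟩
  have hterm : ∀ u ∈ range (N + 1), F (r + u) = (-1) ^ (n - r) * v ^ e r
      * ((-1) ^ u * (v ^ 2) ^ u.choose 2 * (v ^ (-2 * D : ℤ)) ^ u * gaussBinom (v ^ 2) N u) := by
    intro u hu
    have hu : u ≤ N := Nat.lt_succ_iff.1 (mem_range.1 hu)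
    have hsign : (-1 : ℝ) ^ (n - (r + u)) = (-1) ^ (n - r) * (-1) ^ u := by
      rw [show n - r = n - (r + u) + u by omega, pow_add, mul_assoc, ← mul_pow]
      simp
    have hchoose : 2 * (u.choose 2 : ℤ) = u * (u - 1) := by
      have h : (u.choose 2 : ℚ) = u * (u - 1) / 2 := Nat.cast_choose_two ℚ u
      have h' : (2 * (u.choose 2 : ℤ) : ℚ) = u * (u - 1) := by push_cast; linarith
      exact_mod_cast h'
    have hexp : v ^ e ((r + u : ℕ) : ℤ)
        = v ^ e r * ((v ^ 2) ^ u.choose 2 * (v ^ (-2 * D : ℤ)) ^ u) := by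
      rw [← pow_mul, ← zpow_natCast v, ← zpow_natCast (v ^ (-2 * D : ℤ)), ← zpow_mul,
        ← zpow_add₀ hv, ← zpow_add₀ hv]
      congr 1
      have hn' : (n : ℤ) = 1 + l * (A + B) := by exact_mod_cast hn
      have hD' : (l : ℤ) * B = r + D := by exact_mod_cast hD
      simp only [e]
      push_cast
      rw [hchoose, hn']
      linear_combination (-2 * (u : ℤ)) * hD'
    simp only [F]
    rw [hf', hsign, hexp]
    ring
  rw [hM, sum_range_add, sum_eq_zero fun s hs => ?_, zero_add, sum_range_add,
    sum_eq_zero (s := range M) fun s _ => ?_, add_zero, sum_congr rfl hterm, ← mul_sum,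
    sum_gaussBinom, prod_eq_zero (i := D) (mem_range.2 (by omega)), mul_zero]
  · rw [← pow_mul, ← zpow_natCast v, ← zpow_add₀ hv]
    simp
  · simp only [F]
    rw [hf', gaussBinom_eq_zero_of_lt _ (by omega), mul_zero]
  · simp only [F]
    rw [hf s (mem_range.1 hs), mul_zero]

theorem qfact_ne_zero {v : ℝ} (hv : 1 < v) (t : ℕ) : qfact v t ≠ 0 := by
  have h : v⁻¹ < 1 := inv_lt_one_of_one_lt₀ hv
  have h' : 0 < v⁻¹ := by positivity
  refine prod_ne_zero_iff.2 fun j _ => div_ne_zero (sub_ne_zero.2 ?_) (by linarith)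
  exact ((pow_lt_one₀ h'.le h j.succ_ne_zero).trans (one_lt_pow₀ hv j.succ_ne_zero)).ne'

/-- The quantum Serre relation at distinct vertices. -/
theorem serre_of_ne {v : ℝ} (hv : 1 < v) (hvq : v ^ 2 = Fintype.card k) {i j : I} (hij : i ≠ j)
    (hi : c i i = 0) {l n : ℕ} (hn : n = 1 + l * (c i j + c j i)) :
    ∑ t ∈ range (n + 1), ((-1 : ℝ) ^ t * (qfact v t)⁻¹ * (qfact v (n - t))⁻¹)
        • hmul v (hpow v (hbasis (ERep i 1 : QRep k c)) t)
            (hmul v (hbasis (ERep j l : QRep k c))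
              (hpow v (hbasis (ERep i 1 : QRep k c)) (n - t))) = 0 := by
  have h0 : v ≠ 0 := by positivity
  ext L
  obtain ⟨L, rfl⟩ := QRep.cl_surjective L
  have hterm : ∀ t ∈ range (n + 1), (((-1 : ℝ) ^ t * (qfact v t)⁻¹ * (qfact v (n - t))⁻¹)
        • hmul v (hpow v (hbasis (ERep i 1 : QRep k c)) t)
            (hmul v (hbasis (ERep j l : QRep k c))
              (hpow v (hbasis (ERep i 1 : QRep k c)) (n - t)))) L.cl
      = (-1 : ℝ) ^ t * (v ^ ((t : ℤ) * (t - 1)) * v ^ (((n - t : ℕ) : ℤ) * ((n - t : ℕ) - 1))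
        * (v ^ ((t : ℤ) * (n - t : ℕ) - c i j * t * l) * v ^ (-(c j i : ℤ) * l * (n - t : ℕ))
        * Nat.card {Y : QSubRep L // IsExtension i j l (n - t) Y.toRep
            ∧ QRepIso Y.quotRep (ERep i t)})) := by
    intro t _
    have hj := hmul_smul_smul v 1 (v ^ (((n - t : ℕ) : ℤ) * ((n - t : ℕ) - 1)) * qfact v (n - t))
      (hbasis (ERep j l : QRep k c)) (hbasis (ERep i (n - t)))
    rw [one_smul] at hj
    rw [hpow_ERep_one hv hvq hi, hpow_ERep_one hv hvq hi, hj, hmul_smul_smul, smul_smul,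
      Pi.smul_apply, hmul_hmul_ERep_cl h0 hi hij, smul_eq_mul]
    have h1 := qfact_ne_zero hv t
    have h2 := qfact_ne_zero hv (n - t)
    field_simp
  rw [Finset.sum_apply, sum_congr rfl hterm, Pi.zero_apply]
  by_cases hL : dimv L = Pi.single j l + Pi.single i n ∧ ∀ x, L.x j j x = 0
  · set R : Submodule k (L.V i) := ⨆ x, LinearMap.range (L.x j i x) with hR
    set K : Submodule k (L.V i) := ⨅ x, LinearMap.ker (L.x i j x) with hK
    have hLi : finrank k (L.V i) = n := by
      have h := congrFun hL.1 i
      rwa [Pi.add_apply, Pi.single_eq_of_ne hij, Pi.single_eq_same, zero_add] at h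
    have hLj : finrank k (L.V j) = l := by
      have h := congrFun hL.1 j
      rwa [Pi.add_apply, Pi.single_eq_of_ne hij.symm, Pi.single_eq_same, add_zero] at h
    have hRle : finrank k R ≤ l * c j i := by
      have h := finrank_iSup_range_le (fun x => L.x j i x)
      rwa [Fintype.card_fin, hLj, mul_comm] at h
    have hKle : n ≤ finrank k K + l * c i j := by
      have h := finrank_le_finrank_iInf_ker_add (fun x => L.x i j x)
      rwa [Fintype.card_fin, hLj, hLi, mul_comm (c i j)] at h
    have hKn : finrank k K ≤ n := hLi ▸ Submodule.finrank_le K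
    have hcard : ∀ t ∈ range (n + 1), Nat.card {Y : QSubRep L //
          IsExtension i j l (n - t) Y.toRep ∧ QRepIso Y.quotRep (ERep i t)}
        = Nat.card {W : Submodule k (L.V i) // finrank k W = n - t ∧ R ≤ W ∧ W ≤ K} := by
      intro t ht
      have ht : t ≤ n := Nat.lt_succ_iff.1 (mem_range.1 ht)
      exact card_subRep_quot_ERep hi hij l (n - t) t
        (by rw [hL.1, Nat.add_sub_cancel' ht]) hL.2
    rw [sum_congr rfl fun t ht => by rw [hcard t ht]]
    by_cases hRK : R ≤ K
    · have hRK' := Submodule.finrank_mono hRK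
      rw [mul_add] at hn
      refine serre_sum_eq_zero h0 (r := finrank k R) (N := finrank k K - finrank k R)
        (by rw [hn, mul_add]) hRle (by omega) (by omega)
        (fun s => Nat.card {W : Submodule k (L.V i) // finrank k W = s ∧ R ≤ W ∧ W ≤ K})
        (fun s hs => ?_) (fun u => ?_)
      · have : IsEmpty {W : Submodule k (L.V i) // finrank k W = s ∧ R ≤ W ∧ W ≤ K} :=
          ⟨fun ⟨W, h1, h2, _⟩ => by have := Submodule.finrank_mono h2; omega⟩
        rw [Nat.card_of_isEmpty, Nat.cast_zero]
      · rw [card_submodule_between hRK, hvq]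
    · refine sum_eq_zero fun t _ => ?_
      have : IsEmpty {W : Submodule k (L.V i) // finrank k W = n - t ∧ R ≤ W ∧ W ≤ K} :=
        ⟨fun W => hRK (W.2.2.1.trans W.2.2.2)⟩
      rw [Nat.card_of_isEmpty, Nat.cast_zero, mul_zero, mul_zero, mul_zero]
  · refine sum_eq_zero fun t ht => ?_
    have ht : t ≤ n := Nat.lt_succ_iff.1 (mem_range.1 ht)
    have := isEmpty_subRep_quot_ERep hij l (n - t) t (L := L) (by rwa [Nat.add_sub_cancel' ht])
    rw [Nat.card_of_isEmpty, Nat.cast_zero, mul_zero, mul_zero, mul_zero]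

/-- Quantum Serre relations in the twisted Ringel-Hall algebra: for a loop-free vertex
`i` and `(j, l) ≠ (i, 1)`, with `a_{ij} = -c_{ij} - c_{ji}` for `i ≠ j` (and `a_{ii} = 2`),
`∑_{t=0}^{1 - l a_{ij}} (-1)^t [E_i]^{(t)} [E_{j,l}] [E_i]^{(1 - l a_{ij} - t)} = 0`,
where `[E_i]^{(t)} = [E_i]^t / [t]_v!`. -/
theorem hall_quantum_serre (v : ℝ) (hv : 0 < v) (hvq : v ^ 2 = Fintype.card k)
    (i j : I) (l : ℕ) (hl : 1 ≤ l) (hi : c i i = 0) (hjl : (j, l) ≠ (i, 1)) :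
    ∑ t ∈ Finset.range ((1 - (l : ℤ) * (if i = j then 2 else -(c i j : ℤ) - c j i) + 1).toNat),
      ((-1 : ℝ) ^ t * (qfact v t)⁻¹
          * (qfact v ((1 - (l : ℤ) * (if i = j then 2 else -(c i j : ℤ) - c j i)).toNat - t))⁻¹)
        • hmul v (hpow v (hbasis (ERep i 1 : QRep k c)) t)
            (hmul v (hbasis (ERep j l : QRep k c))
              (hpow v (hbasis (ERep i 1 : QRep k c))
                ((1 - (l : ℤ) * (if i = j then 2 else -(c i j : ℤ) - c j i)).toNat - t)))
      = 0 := by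
  have hv1 : 1 < v := by
    have h : (1 : ℝ) < Fintype.card k := by exact_mod_cast Fintype.one_lt_card
    nlinarith
  by_cases hij : i = j
  · have hl2 : l ≠ 1 := fun h => hjl (by rw [h, hij])
    rw [if_pos hij, Int.toNat_of_nonpos (by omega), range_zero, sum_empty]
  · have hn : 1 - (l : ℤ) * (-(c i j : ℤ) - c j i) = ((1 + l * (c i j + c j i) : ℕ) : ℤ) := by
      push_cast
      ring
    rw [if_neg hij, hn, Int.toNat_natCast, Int.toNat_natCast_add_one]
    exact serre_of_ne hv1 hvq hij hi rfl
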